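/- For every integer n ≥ 1, the element ρ_n^n = ρ_1 (ρ_n ρ_1)^{n−1} of M_n is both the right-lcm and the left-lcm of the generators ρ_1, ρ_2, …, ρ_n: every ρ_i left-divides ρ_n^n and ρ_n^n left-divides every element left-divided by all the ρ_i, and likewise every ρ_i right-divides ρ_n^n and ρ_n^n right-divides every element right-divided by all the ρ_i. -/

import Mathlib

/-- The defining relations of the monoid `M_n`: the generator `k : Fin n` represents `ρ_{k+1}`
(so that `ρ_i` corresponds to the index `i - 1`), and the relations are
`ρ_1 ρ_n ρ_i = ρ_{i+1} ρ_n` for `1 ≤ i ≤ n - 1`. -/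
inductive MnRel (n : ℕ) : FreeMonoid (Fin n) → FreeMonoid (Fin n) → Prop
  | rel (i : ℕ) (h1 : 1 ≤ i) (h2 : i ≤ n - 1) :
      MnRel n
        (FreeMonoid.of ⟨1 - 1, by omega⟩ * FreeMonoid.of ⟨n - 1, by omega⟩ *
          FreeMonoid.of ⟨i - 1, by omega⟩)
        (FreeMonoid.of ⟨i + 1 - 1, by omega⟩ * FreeMonoid.of ⟨n - 1, by omega⟩)

/-- The presented monoid `M_n`. -/
abbrev Mn (n : ℕ) := PresentedMonoid (MnRel n)

/-- The generator `ρ_i` of `M_n`, for `1 ≤ i ≤ n` (junk value `1` out of range). -/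
def rho (n : ℕ) (i : ℕ) : Mn n :=
  if h : 1 ≤ i ∧ i ≤ n then PresentedMonoid.of (MnRel n) ⟨i - 1, by omega⟩ else 1

/-- `a` left-divides `c`: `c = a * b` for some `b`. -/
def LDvd {M : Type*} [Monoid M] (a c : M) : Prop := ∃ b, a * b = c

/-- `a` right-divides `c`: `c = b * a` for some `b`. -/
def RDvd {M : Type*} [Monoid M] (a c : M) : Prop := ∃ b, b * a = c

/-! ## Basic relations -/

theorem rho_eq_of (n : ℕ) (k : Fin n) : PresentedMonoid.of (MnRel n) k = rho n (k.1 + 1) := by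
  have h : 1 ≤ k.1 + 1 ∧ k.1 + 1 ≤ n := ⟨by omega, k.2⟩
  simp [rho, h]

theorem rho_rel (n i : ℕ) (h1 : 1 ≤ i) (h2 : i + 1 ≤ n) :
    rho n 1 * rho n n * rho n i = rho n (i + 1) * rho n n := by
  have h := MnRel.rel (n := n) i h1 (by omega)
  have h' : PresentedMonoid.mk (MnRel n) _ = PresentedMonoid.mk (MnRel n) _ :=
    (Con.eq _).2 (ConGen.Rel.of _ _ h)
  have e1 : rho n 1 = PresentedMonoid.of (MnRel n) ⟨1 - 1, by omega⟩ := by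
    rw [rho, dif_pos ⟨by omega, by omega⟩]
  have e2 : rho n n = PresentedMonoid.of (MnRel n) ⟨n - 1, by omega⟩ := by
    rw [rho, dif_pos ⟨by omega, by omega⟩]
  have e3 : rho n i = PresentedMonoid.of (MnRel n) ⟨i - 1, by omega⟩ := by
    rw [rho, dif_pos ⟨by omega, by omega⟩]
  have e4 : rho n (i + 1) = PresentedMonoid.of (MnRel n) ⟨i + 1 - 1, by omega⟩ := by
    rw [rho, dif_pos ⟨by omega, by omega⟩]
  rw [e1, e2, e3, e4]
  exact h'

/-- The element `y = ρ_1 ρ_n`. -/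
def yy (n : ℕ) : Mn n := rho n 1 * rho n n

theorem yy_pow (n k i : ℕ) (h1 : 1 ≤ i) (h2 : i + k ≤ n) :
    yy n ^ k * rho n i = rho n (i + k) * rho n n ^ k := by
  induction k generalizing i with
  | zero => simp
  | succ k ih =>
    rw [pow_succ, mul_assoc, yy, rho_rel n i h1 (by omega), ← mul_assoc]
    have := ih (i + 1) (by omega) (by omega)
    rw [yy] at this
    rw [this, mul_assoc, ← pow_succ, show i + 1 + k = i + (k + 1) by ring]

theorem yy_pow_eq (n k : ℕ) (h1 : 1 ≤ k) (h2 : k ≤ n) :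
    yy n ^ k = rho n k * rho n n ^ k := by
  obtain ⟨k, rfl⟩ : ∃ m, k = m + 1 := ⟨k - 1, by omega⟩
  have := yy_pow n k 1 le_rfl (by omega)
  rw [pow_succ]
  nth_rewrite 2 [yy]
  rw [← mul_assoc, this, mul_assoc, ← pow_succ, add_comm 1 k]

theorem yy_top (n k i : ℕ) (h1 : 1 ≤ i) (h2 : i + k = n) :
    yy n ^ k * rho n i = rho n n ^ (k + 1) := by
  rw [yy_pow n k i h1 h2.le, h2, pow_succ']

theorem rho_comb (n k i : ℕ) (h0 : 1 ≤ k) (h1 : 1 ≤ i) (h2 : i + k ≤ n) :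
    rho n k * (rho n n ^ k * rho n i) = rho n (i + k) * rho n n ^ k := by
  rw [← mul_assoc, ← yy_pow_eq n k h0 (by omega), yy_pow n k i h1 h2]

/-! ## Weight -/

/-- The weight homomorphism, `ρ_i ↦ i`. -/
def wtHom (n : ℕ) : Mn n →* Multiplicative ℕ :=
  PresentedMonoid.lift (fun k : Fin n => Multiplicative.ofAdd (k.1 + 1)) (by
    intro a b h
    cases h with
    | rel i h1 h2 =>
      simp only [map_mul, FreeMonoid.lift_eval_of, ← ofAdd_add]
      congr 1
      omega)

/-- The weight. -/
def wt {n : ℕ} (a : Mn n) : ℕ := Multiplicative.toAdd (wtHom n a)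

theorem wt_mul {n : ℕ} (a b : Mn n) : wt (a * b) = wt a + wt b := by
  simp [wt]

theorem wt_rho (n i : ℕ) (h1 : 1 ≤ i) (h2 : i ≤ n) : wt (rho n i) = i := by
  rw [rho, dif_pos ⟨h1, h2⟩, wt, wtHom, PresentedMonoid.lift_of]
  simp; omega

theorem wt_of (n : ℕ) (k : Fin n) : wt (PresentedMonoid.of (MnRel n) k) = k.1 + 1 := by
  rw [rho_eq_of, wt_rho n _ (by omega) k.2]

/-! ## Left side -/

/-- Conclusion on `ρ_i a = ρ_j b`. -/
def EL (n i j : ℕ) (a b : Mn n) : Prop :=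
  (i = j → a = b) ∧
  (i < j → ∃ d, a = rho n n ^ i * (rho n (j - i) * d) ∧ b = rho n n ^ i * d) ∧
  (j < i → ∃ d, b = rho n n ^ j * (rho n (i - j) * d) ∧ a = rho n n ^ j * d)

theorem EL.symm {n i j : ℕ} {a b : Mn n} (h : EL n i j a b) : EL n j i b a :=
  ⟨fun e => (h.1 e.symm).symm, h.2.2, h.2.1⟩

theorem EL.mul {n i j : ℕ} {a b c : Mn n} (h : EL n i j a b) : EL n i j (a * c) (b * c) := by
  refine ⟨fun e => by rw [h.1 e], fun e => ?_, fun e => ?_⟩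
  · obtain ⟨d, rfl, rfl⟩ := h.2.1 e
    exact ⟨d * c, by simp only [mul_assoc], by simp only [mul_assoc]⟩
  · obtain ⟨d, rfl, rfl⟩ := h.2.2 e
    exact ⟨d * c, by simp only [mul_assoc], by simp only [mul_assoc]⟩

/-- Induction hypothesis. -/
def HL (n N : ℕ) : Prop := ∀ i j : ℕ, 1 ≤ i → i ≤ n → 1 ≤ j → j ≤ n → ∀ a b : Mn n,
  wt (rho n i * a) < N → rho n i * a = rho n j * b → EL n i j a b

theorem HL.cancel {n N : ℕ} (hn : 1 ≤ n) (H : HL n N) (m : ℕ) (a b : Mn n)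
    (hw : wt (rho n n ^ m * a) < N) (h : rho n n ^ m * a = rho n n ^ m * b) : a = b := by
  induction m with
  | zero => simpa using h
  | succ m ih =>
    rw [pow_succ', mul_assoc, mul_assoc] at h
    rw [pow_succ', mul_assoc] at hw
    have := (H n n hn le_rfl hn le_rfl _ _ hw h).1 rfl
    rw [wt_mul] at hw
    exact ih (by omega) this

theorem EL.trans_lt {n N i j k : ℕ} (hi : 1 ≤ i) (hjn : j ≤ n)
    (hk : 1 ≤ k) (hkn : k ≤ n) (H : HL n N) {a b c : Mn n} (hw : wt c < N)
    (h1 : EL n i k a c) (h2 : EL n k j c b) (hij : i < j) : EL n i j a b := by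
  refine ⟨fun e => absurd e (by omega), fun _ => ?_, fun e => absurd e (by omega)⟩
  rcases lt_trichotomy i k with hik | hik | hik
  · obtain ⟨d, rfl, hc⟩ := h1.2.1 hik
    rcases lt_trichotomy k j with hkj | hkj | hkj
    · obtain ⟨e, hc', rfl⟩ := h2.2.1 hkj
      rw [hc'] at hc hw
      obtain ⟨m, rfl⟩ : ∃ m, k = i + m := ⟨k - i, by omega⟩
      rw [pow_add, mul_assoc] at hc hw
      have := H.cancel (by omega) _ _ _ hw hc
      subst this
      refine ⟨rho n n ^ m * e, ?_, by rw [pow_add, mul_assoc]⟩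
      have := rho_comb n m (j - (i + m)) (by omega) (by omega) (by omega)
      rw [show j - (i + m) + m = j - i by omega] at this
      rw [← mul_assoc (rho n (j - i)), ← this, Nat.add_sub_cancel_left]
      simp only [mul_assoc]
    · subst hkj
      have := h2.1 rfl
      subst this
      exact ⟨d, rfl, hc⟩
    · obtain ⟨e, rfl, hc'⟩ := h2.2.2 hkj
      rw [hc] at hc' hw
      obtain ⟨m, rfl⟩ : ∃ m, j = i + m := ⟨j - i, by omega⟩
      rw [pow_add, mul_assoc] at hc'
      have := H.cancel (by omega) _ _ _ hw hc'
      subst this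
      refine ⟨rho n n ^ m * (rho n (k - (i + m)) * e), ?_, by rw [pow_add, mul_assoc]⟩
      have := rho_comb n m (k - (i + m)) (by omega) (by omega) (by omega)
      rw [show k - (i + m) + m = k - i by omega] at this
      rw [← mul_assoc (rho n (k - i)), ← this, Nat.add_sub_cancel_left]
      simp only [mul_assoc]
  · subst hik
    rw [h1.1 rfl]
    exact h2.2.1 hij
  · obtain ⟨d, hc, rfl⟩ := h1.2.2 hik
    obtain ⟨e, hc', rfl⟩ := h2.2.1 (by omega)
    rw [hc] at hc' hw
    have h3 := H.cancel (by omega) _ _ _ hw hc'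
    rw [wt_mul] at hw
    have h4 := (H (i - k) (j - k) (by omega) (by omega) (by omega) (by omega) _ _
      (by omega) h3).2.1 (by omega)
    obtain ⟨f, rfl, rfl⟩ := h4
    refine ⟨f, ?_, ?_⟩
    · rw [← mul_assoc, ← pow_add, show k + (i - k) = i by omega,
        show j - k - (i - k) = j - i by omega]
    · rw [← mul_assoc, ← pow_add, show k + (i - k) = i by omega]

theorem EL.trans_all {n N i j k : ℕ} (hi : 1 ≤ i) (hin : i ≤ n) (hj : 1 ≤ j) (hjn : j ≤ n)
    (hk : 1 ≤ k) (hkn : k ≤ n) (H : HL n N) {a b c : Mn n} (hw : wt c < N)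
    (h1 : EL n i k a c) (h2 : EL n k j c b) : EL n i j a b := by
  rcases lt_trichotomy i j with hij | hij | hij
  · exact EL.trans_lt hi hjn hk hkn H hw h1 h2 hij
  · subst hij
    refine ⟨fun _ => ?_, fun e => absurd e (by omega), fun e => absurd e (by omega)⟩
    rcases lt_trichotomy i k with hik | hik | hik
    · obtain ⟨d, rfl, hc⟩ := h1.2.1 hik
      obtain ⟨e, rfl, hc'⟩ := h2.2.2 hik
      rw [hc] at hc' hw
      rw [H.cancel (by omega) _ _ _ hw hc']
    · subst hik
      rw [h1.1 rfl, h2.1 rfl]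
    · obtain ⟨d, hc, rfl⟩ := h1.2.2 hik
      obtain ⟨e, hc', rfl⟩ := h2.2.1 hik
      rw [hc] at hc' hw
      have h3 := H.cancel (by omega) _ _ _ hw hc'
      rw [wt_mul] at hw
      rw [(H (i - k) (i - k) (by omega) (by omega) (by omega) (by omega) _ _
        (by omega) h3).1 rfl]
  · exact (EL.trans_lt hj hin hk hkn H hw h2.symm h1.symm hij).symm

/-- Projection of words. -/
abbrev mkw (n : ℕ) (u : FreeMonoid (Fin n)) : Mn n := PresentedMonoid.mk (MnRel n) u

theorem mkw_of (n : ℕ) (k : Fin n) : mkw n (FreeMonoid.of k) = rho n (k.1 + 1) := rho_eq_of n k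

theorem mkw_mul (n : ℕ) (u v : FreeMonoid (Fin n)) : mkw n (u * v) = mkw n u * mkw n v :=
  map_mul _ _ _

theorem mkw_surj (n : ℕ) (a : Mn n) : ∃ u, PresentedMonoid.mk (MnRel n) u = a :=
  Con.mk'_surjective a

theorem mkw_one (n : ℕ) : mkw n 1 = 1 := map_one _

theorem wt_one (n : ℕ) : wt (1 : Mn n) = 0 := by simp [wt]

theorem word_cases {n : ℕ} (u : FreeMonoid (Fin n)) :
    u = 1 ∨ ∃ i a, u = FreeMonoid.of i * a := by
  cases u using FreeMonoid.casesOn with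
  | one => exact Or.inl rfl
  | of_mul i a => exact Or.inr ⟨i, a, rfl⟩

theorem eq_one_of_wt {n : ℕ} (u : FreeMonoid (Fin n)) (h : wt (mkw n u) = 0) : u = 1 := by
  rcases word_cases u with rfl | ⟨i, a, rfl⟩
  · rfl
  · rw [mkw_mul, wt_mul, mkw_of, wt_rho n _ (by omega) i.2] at h
    omega

theorem of_mul_inj {n : ℕ} {i j : Fin n} {a b : FreeMonoid (Fin n)}
    (h : FreeMonoid.of i * a = FreeMonoid.of j * b) : i = j ∧ a = b := by
  have h' := congrArg FreeMonoid.toList h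
  simpa using h'

theorem word_EL {n N : ℕ} (H : HL n N) (u v : FreeMonoid (Fin n))
    (h : ConGen.Rel (MnRel n) u v) :
    mkw n u = mkw n v ∧ (wt (mkw n u) ≤ N → ∀ i a j b, u = FreeMonoid.of i * a →
      v = FreeMonoid.of j * b → EL n (i.1 + 1) (j.1 + 1) (mkw n a) (mkw n b)) := by
  induction h with
  | of u v h =>
    refine ⟨(Con.eq _).2 (ConGen.Rel.of _ _ h), ?_⟩
    cases h with
    | rel k h1 h2 =>
      intro _ i a j b hu hv
      rw [mul_assoc] at hu
      obtain ⟨rfl, rfl⟩ := of_mul_inj hu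
      obtain ⟨rfl, rfl⟩ := of_mul_inj hv
      refine ⟨fun e => ?_, fun e => ⟨1, ?_, ?_⟩, fun e => ?_⟩
      · simp at e; omega
      · simp only [mkw_mul, mkw_of, mul_one]
        rw [show n - 1 + 1 = n by omega, show 1 - 1 + 1 = 1 by omega, pow_one,
          show k + 1 - 1 + 1 - 1 = k - 1 + 1 by omega]
      · simp only [mkw_of, mul_one]
        rw [show n - 1 + 1 = n by omega, show 1 - 1 + 1 = 1 by omega, pow_one]
      · simp at e
  | refl u =>
    refine ⟨rfl, ?_⟩
    intro _ i a j b hu hv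
    obtain ⟨rfl, rfl⟩ := of_mul_inj (hu.symm.trans hv)
    exact ⟨fun _ => rfl, fun e => absurd e (by omega), fun e => absurd e (by omega)⟩
  | symm _ ih =>
    refine ⟨ih.1.symm, fun hw i a j b hu hv => ?_⟩
    rw [← ih.1] at hw
    exact (ih.2 hw j b i a hv hu).symm
  | @trans u v w _ _ ih1 ih2 =>
    refine ⟨ih1.1.trans ih2.1, fun hw i a j b hu hv => ?_⟩
    have hw2 := hw
    rw [ih1.1] at hw2
    rcases word_cases v with rfl | ⟨k, c, rfl⟩
    · have := ih1.1
      rw [hu, mkw_mul] at this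
      have := congrArg wt this
      rw [wt_mul, mkw_of, wt_rho n _ (by omega) i.2, mkw_one, wt_one] at this
      omega
    · have e1 := ih1.2 hw i a k c hu rfl
      have e2 := ih2.2 hw2 k c j b rfl hv
      rw [mkw_mul, wt_mul, mkw_of, wt_rho n _ (by omega) k.2] at hw2
      exact EL.trans_all (by omega) i.2 (by omega) j.2 (by omega) k.2 H (by omega) e1 e2
  | @mul u u' v v' _ _ ih1 ih2 =>
    refine ⟨by rw [mkw_mul, mkw_mul, ih1.1, ih2.1], fun hw i a j b hu hv => ?_⟩
    rw [mkw_mul, wt_mul] at hw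
    rcases word_cases u with rfl | ⟨i', a', rfl⟩
    · have : u' = 1 := eq_one_of_wt _ (by rw [← ih1.1, mkw_one, wt_one])
      subst this
      rw [one_mul] at hu hv
      exact ih2.2 (by omega) i a j b hu hv
    · rcases word_cases u' with rfl | ⟨j', b', rfl⟩
      · have := eq_one_of_wt _ (by rw [ih1.1, mkw_one, wt_one])
        rw [this, one_mul] at hu
        rw [one_mul] at hv
        exact ih2.2 (by omega) i a j b hu hv
      · rw [mul_assoc] at hu hv
        obtain ⟨rfl, rfl⟩ := of_mul_inj hu
        obtain ⟨rfl, rfl⟩ := of_mul_inj hv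
        rw [mkw_mul, mkw_mul, ← ih2.1]
        exact (ih1.2 (by omega) _ _ _ _ rfl rfl).mul

theorem HL_all (n N : ℕ) : HL n N := by
  induction N with
  | zero => intro i j _ _ _ _ a b h; omega
  | succ N ih =>
    intro i j hi hin hj hjn a b hw h
    obtain ⟨a, rfl⟩ := mkw_surj n a
    obtain ⟨b, rfl⟩ := mkw_surj n b
    obtain ⟨i, rfl⟩ : ∃ m, i = m + 1 := ⟨i - 1, by omega⟩
    obtain ⟨j, rfl⟩ : ∃ m, j = m + 1 := ⟨j - 1, by omega⟩
    have e1 : rho n (i + 1) * PresentedMonoid.mk (MnRel n) a =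
      mkw n (FreeMonoid.of ⟨i, hin⟩ * a) := by rw [mkw_mul, mkw_of]
    have e2 : rho n (j + 1) * PresentedMonoid.mk (MnRel n) b =
      mkw n (FreeMonoid.of ⟨j, hjn⟩ * b) := by rw [mkw_mul, mkw_of]
    rw [e1] at hw h
    rw [e2] at h
    have h' : ConGen.Rel (MnRel n) _ _ := (Con.eq _).1 h
    exact (word_EL ih _ _ h').2 (by omega) ⟨i, hin⟩ a ⟨j, hjn⟩ b rfl rfl

/-! ## Right side -/

/-- Conclusion on `a ρ_i = b ρ_j`. -/
def ER (n i j : ℕ) (a b : Mn n) : Prop :=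
  (i = j → a = b) ∧
  (i < j → ∃ d, a = d * yy n ^ (n - j + 1) ∧ b = d * rho n (n - j + i + 1) * yy n ^ (n - j)) ∧
  (j < i → ∃ d, b = d * yy n ^ (n - i + 1) ∧ a = d * rho n (n - i + j + 1) * yy n ^ (n - i))

theorem ER.symm {n i j : ℕ} {a b : Mn n} (h : ER n i j a b) : ER n j i b a :=
  ⟨fun e => (h.1 e.symm).symm, h.2.2, h.2.1⟩

theorem ER.mul {n i j : ℕ} {a b c : Mn n} (h : ER n i j a b) : ER n i j (c * a) (c * b) := by
  refine ⟨fun e => by rw [h.1 e], fun e => ?_, fun e => ?_⟩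
  · obtain ⟨d, rfl, rfl⟩ := h.2.1 e
    exact ⟨c * d, by simp only [mul_assoc], by simp only [mul_assoc]⟩
  · obtain ⟨d, rfl, rfl⟩ := h.2.2 e
    exact ⟨c * d, by simp only [mul_assoc], by simp only [mul_assoc]⟩

/-- Induction hypothesis. -/
def HR (n N : ℕ) : Prop := ∀ i j : ℕ, 1 ≤ i → i ≤ n → 1 ≤ j → j ≤ n → ∀ a b : Mn n,
  wt (a * rho n i) < N → a * rho n i = b * rho n j → ER n i j a b

theorem HR.cancel {n N : ℕ} (hn : 1 ≤ n) (H : HR n N) (m : ℕ) (a b : Mn n)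
    (hw : wt (a * yy n ^ m) < N) (h : a * yy n ^ m = b * yy n ^ m) : a = b := by
  induction m with
  | zero => simpa using h
  | succ m ih =>
    have hy : yy n ^ (m + 1) = yy n ^ m * rho n 1 * rho n n := by
      rw [pow_succ, mul_assoc]; rfl
    rw [hy] at h hw
    simp only [← mul_assoc] at h hw
    have h1 := (H n n hn le_rfl hn le_rfl _ _ hw h).1 rfl
    rw [wt_mul] at hw
    have h2 := (H 1 1 le_rfl hn le_rfl hn _ _ (by omega) h1).1 rfl
    rw [wt_mul] at hw
    exact ih (by omega) h2

theorem ER.trans_lt {n N i j k : ℕ} (hi : 1 ≤ i) (hjn : j ≤ n)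
    (hk : 1 ≤ k) (hkn : k ≤ n) (H : HR n N) {a b c : Mn n} (hw : wt c < N)
    (h1 : ER n i k a c) (h2 : ER n k j c b) (hij : i < j) : ER n i j a b := by
  refine ⟨fun e => absurd e (by omega), fun _ => ?_, fun e => absurd e (by omega)⟩
  rcases lt_trichotomy i k with hik | hik | hik
  · obtain ⟨d, rfl, hc⟩ := h1.2.1 hik
    rcases lt_trichotomy k j with hkj | hkj | hkj
    · obtain ⟨e, hc', rfl⟩ := h2.2.1 hkj
      have hc2 : (d * rho n (n - k + i + 1) * yy n ^ (j - k - 1)) * yy n ^ (n - j + 1) =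
          e * yy n ^ (n - j + 1) := by
        rw [← hc', hc, mul_assoc, ← pow_add, show j - k - 1 + (n - j + 1) = n - k by omega]
      rw [hc', ← hc2] at hw
      have := H.cancel (by omega) _ _ _ hw hc2
      subst this
      refine ⟨d * yy n ^ (j - k), ?_, ?_⟩
      · rw [mul_assoc, ← pow_add, show j - k + (n - j + 1) = n - k + 1 by omega]
      · have t1 := yy_pow n (j - k) (n - j + i + 1) (by omega) (by omega)
        have t2 := yy_top n (j - k - 1) (n - j + k + 1) (by omega) (by omega)
        rw [show n - j + i + 1 + (j - k) = n - k + i + 1 by omega] at t1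
        rw [show j - k - 1 + 1 = j - k by omega] at t2
        rw [mul_assoc d (yy n ^ (j - k)), t1, mul_assoc (d * _) (yy n ^ (j - k - 1)), t2]
        simp only [mul_assoc]
    · subst hkj
      have := h2.1 rfl
      subst this
      exact ⟨d, rfl, hc⟩
    · obtain ⟨e, rfl, hc'⟩ := h2.2.2 hkj
      rw [hc] at hc' hw
      have h3 := H.cancel (by omega) _ _ _ hw hc'
      rw [wt_mul] at hw
      have h4 := (H (n - k + i + 1) (n - k + j + 1) (by omega) (by omega) (by omega) (by omega)
        _ _ (by omega) h3).2.1 (by omega)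
      obtain ⟨f, rfl, rfl⟩ := h4
      refine ⟨f, ?_, ?_⟩
      · rw [mul_assoc, ← pow_add,
          show n - (n - k + j + 1) + 1 + (n - k + 1) = n - j + 1 by omega]
      · rw [mul_assoc (f * _), ← pow_add,
          show n - (n - k + j + 1) + (n - k + 1) = n - j by omega,
          show n - (n - k + j + 1) + (n - k + i + 1) + 1 = n - j + i + 1 by omega]
  · subst hik
    rw [h1.1 rfl]
    exact h2.2.1 hij
  · obtain ⟨d, hc, rfl⟩ := h1.2.2 hik
    obtain ⟨e, hc', rfl⟩ := h2.2.1 (by omega)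
    have hc2 : (d * yy n ^ (j - i)) * yy n ^ (n - j + 1) = e * yy n ^ (n - j + 1) := by
      rw [← hc', hc, mul_assoc, ← pow_add, show j - i + (n - j + 1) = n - i + 1 by omega]
    rw [hc', ← hc2] at hw
    have := H.cancel (by omega) _ _ _ hw hc2
    subst this
    refine ⟨d * rho n (n - i + k + 1) * yy n ^ (j - i - 1), ?_, ?_⟩
    · rw [mul_assoc (d * _), ← pow_add, show j - i - 1 + (n - j + 1) = n - i by omega]
    · have t1 := yy_pow n (j - i) (n - j + k + 1) (by omega) (by omega)
      have t2 := yy_top n (j - i - 1) (n - j + i + 1) (by omega) (by omega)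
      rw [show n - j + k + 1 + (j - i) = n - i + k + 1 by omega] at t1
      rw [show j - i - 1 + 1 = j - i by omega] at t2
      rw [mul_assoc d (yy n ^ (j - i)), t1, mul_assoc (d * _) (yy n ^ (j - i - 1)), t2]
      simp only [mul_assoc]

theorem ER.trans_all {n N i j k : ℕ} (hi : 1 ≤ i) (hin : i ≤ n) (hj : 1 ≤ j) (hjn : j ≤ n)
    (hk : 1 ≤ k) (hkn : k ≤ n) (H : HR n N) {a b c : Mn n} (hw : wt c < N)
    (h1 : ER n i k a c) (h2 : ER n k j c b) : ER n i j a b := by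
  rcases lt_trichotomy i j with hij | hij | hij
  · exact ER.trans_lt hi hjn hk hkn H hw h1 h2 hij
  · subst hij
    refine ⟨fun _ => ?_, fun e => absurd e (by omega), fun e => absurd e (by omega)⟩
    rcases lt_trichotomy i k with hik | hik | hik
    · obtain ⟨d, rfl, hc⟩ := h1.2.1 hik
      obtain ⟨e, rfl, hc'⟩ := h2.2.2 hik
      rw [hc] at hc' hw
      have h3 := H.cancel (by omega) _ _ _ hw hc'
      rw [wt_mul] at hw
      rw [(H (n - k + i + 1) (n - k + i + 1) (by omega) (by omega) (by omega) (by omega) _ _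
        (by omega) h3).1 rfl]
    · subst hik
      rw [h1.1 rfl, h2.1 rfl]
    · obtain ⟨d, hc, rfl⟩ := h1.2.2 hik
      obtain ⟨e, hc', rfl⟩ := h2.2.1 hik
      rw [hc] at hc' hw
      rw [H.cancel (by omega) _ _ _ hw hc']
  · exact (ER.trans_lt hj hin hk hkn H hw h2.symm h1.symm hij).symm

theorem word_cases_right {n : ℕ} (u : FreeMonoid (Fin n)) :
    u = 1 ∨ ∃ a i, u = a * FreeMonoid.of i := by
  rcases List.eq_nil_or_concat (FreeMonoid.toList u) with h | ⟨a, i, h⟩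
  · exact Or.inl h
  · refine Or.inr ⟨FreeMonoid.ofList a, i, ?_⟩
    apply FreeMonoid.toList.injective
    simpa using h

theorem mul_of_inj {n : ℕ} {i j : Fin n} {a b : FreeMonoid (Fin n)}
    (h : a * FreeMonoid.of i = b * FreeMonoid.of j) : i = j ∧ a = b := by
  have h' := congrArg FreeMonoid.toList h
  rw [FreeMonoid.toList_mul, FreeMonoid.toList_mul] at h'
  have h2 := List.append_inj' h' rfl
  exact ⟨by simpa using h2.2, FreeMonoid.toList.injective h2.1⟩

theorem word_ER {n N : ℕ} (H : HR n N) (u v : FreeMonoid (Fin n))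
    (h : ConGen.Rel (MnRel n) u v) :
    mkw n u = mkw n v ∧ (wt (mkw n u) ≤ N → ∀ i a j b, u = a * FreeMonoid.of i →
      v = b * FreeMonoid.of j → ER n (i.1 + 1) (j.1 + 1) (mkw n a) (mkw n b)) := by
  induction h with
  | of u v h =>
    refine ⟨(Con.eq _).2 (ConGen.Rel.of _ _ h), ?_⟩
    cases h with
    | rel k h1 h2 =>
      intro _ i a j b hu hv
      obtain ⟨rfl, rfl⟩ := mul_of_inj hu
      obtain ⟨rfl, rfl⟩ := mul_of_inj hv
      refine ⟨fun e => ?_, fun e => ⟨1, ?_, ?_⟩, fun e => ?_⟩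
      · simp at e; omega
      · simp only [mkw_mul, mkw_of, one_mul]
        rw [show n - 1 + 1 = n by omega, show 1 - 1 + 1 = 1 by omega, Nat.sub_self, zero_add,
          pow_one, yy]
      · simp only [mkw_of, one_mul]
        rw [show n - 1 + 1 = n by omega, Nat.sub_self, pow_zero, mul_one,
          show k + 1 - 1 + 1 = 0 + (k - 1 + 1) + 1 by omega]
      · simp at e; omega
  | refl u =>
    refine ⟨rfl, ?_⟩
    intro _ i a j b hu hv
    obtain ⟨rfl, rfl⟩ := mul_of_inj (hu.symm.trans hv)
    exact ⟨fun _ => rfl, fun e => absurd e (by omega), fun e => absurd e (by omega)⟩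
  | symm _ ih =>
    refine ⟨ih.1.symm, fun hw i a j b hu hv => ?_⟩
    rw [← ih.1] at hw
    exact (ih.2 hw j b i a hv hu).symm
  | @trans u v w _ _ ih1 ih2 =>
    refine ⟨ih1.1.trans ih2.1, fun hw i a j b hu hv => ?_⟩
    have hw2 := hw
    rw [ih1.1] at hw2
    rcases word_cases_right v with rfl | ⟨c, k, rfl⟩
    · have := ih1.1
      rw [hu, mkw_mul] at this
      have := congrArg wt this
      rw [wt_mul, mkw_of, wt_rho n _ (by omega) i.2, mkw_one, wt_one] at this
      omega
    · have e1 := ih1.2 hw i a k c hu rfl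
      have e2 := ih2.2 hw2 k c j b rfl hv
      rw [mkw_mul, wt_mul, mkw_of, wt_rho n _ (by omega) k.2] at hw2
      exact ER.trans_all (by omega) i.2 (by omega) j.2 (by omega) k.2 H (by omega) e1 e2
  | @mul u u' v v' _ _ ih1 ih2 =>
    refine ⟨by rw [mkw_mul, mkw_mul, ih1.1, ih2.1], fun hw i a j b hu hv => ?_⟩
    rw [mkw_mul, wt_mul] at hw
    rcases word_cases_right v with rfl | ⟨a', i', rfl⟩
    · have : v' = 1 := eq_one_of_wt _ (by rw [← ih2.1, mkw_one, wt_one])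
      subst this
      rw [mul_one] at hu hv
      exact ih1.2 (by omega) i a j b hu hv
    · rcases word_cases_right v' with rfl | ⟨b', j', rfl⟩
      · have := eq_one_of_wt _ (by rw [ih2.1, mkw_one, wt_one])
        rw [this, mul_one] at hu
        rw [mul_one] at hv
        exact ih1.2 (by omega) i a j b hu hv
      · rw [← mul_assoc] at hu hv
        obtain ⟨rfl, rfl⟩ := mul_of_inj hu
        obtain ⟨rfl, rfl⟩ := mul_of_inj hv
        rw [mkw_mul, mkw_mul, ← ih1.1]
        exact (ih2.2 (by omega) _ _ _ _ rfl rfl).mul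

theorem HR_all (n N : ℕ) : HR n N := by
  induction N with
  | zero => intro i j _ _ _ _ a b h; omega
  | succ N ih =>
    intro i j hi hin hj hjn a b hw h
    obtain ⟨a, rfl⟩ := mkw_surj n a
    obtain ⟨b, rfl⟩ := mkw_surj n b
    obtain ⟨i, rfl⟩ : ∃ m, i = m + 1 := ⟨i - 1, by omega⟩
    obtain ⟨j, rfl⟩ : ∃ m, j = m + 1 := ⟨j - 1, by omega⟩
    have e1 : PresentedMonoid.mk (MnRel n) a * rho n (i + 1) =
      mkw n (a * FreeMonoid.of ⟨i, hin⟩) := by rw [mkw_mul, mkw_of]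
    have e2 : PresentedMonoid.mk (MnRel n) b * rho n (j + 1) =
      mkw n (b * FreeMonoid.of ⟨j, hjn⟩) := by rw [mkw_mul, mkw_of]
    rw [e1] at hw h
    rw [e2] at h
    have h' : ConGen.Rel (MnRel n) _ _ := (Con.eq _).1 h
    exact (word_ER ih _ _ h').2 (by omega) ⟨i, hin⟩ a ⟨j, hjn⟩ b rfl rfl

theorem shift_pow {M : Type*} [Monoid M] (a b : M) (k : ℕ) :
    (a * b) ^ k * a = a * (b * a) ^ k := by
  induction k with
  | zero => simp
  | succ k ih => rw [pow_succ', mul_assoc, ih, pow_succ' (b * a)]; simp only [mul_assoc]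

/-- `ρ_n^n = ρ_1 (ρ_n ρ_1)^{n-1}` is both the right-lcm and the left-lcm of the generators
`ρ_1, …, ρ_n` of `M_n`. -/
theorem stmt9 (n : ℕ) (hn : 1 ≤ n) :
    (rho n n) ^ n = rho n 1 * (rho n n * rho n 1) ^ (n - 1) ∧
    (∀ i : ℕ, 1 ≤ i → i ≤ n → LDvd (rho n i) ((rho n n) ^ n)) ∧
    (∀ w : Mn n, (∀ i : ℕ, 1 ≤ i → i ≤ n → LDvd (rho n i) w) → LDvd ((rho n n) ^ n) w) ∧
    (∀ i : ℕ, 1 ≤ i → i ≤ n → RDvd (rho n i) ((rho n n) ^ n)) ∧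
    (∀ w : Mn n, (∀ i : ℕ, 1 ≤ i → i ≤ n → RDvd (rho n i) w) → RDvd ((rho n n) ^ n) w) := by
  have top : yy n ^ (n - 1) * rho n 1 = rho n n ^ n := by
    rw [yy_top n (n - 1) 1 le_rfl (by omega), Nat.sub_add_cancel hn]
  refine ⟨?_, ?_, ?_, ?_, ?_⟩
  · rw [← top, yy, shift_pow]
  · intro i hi hin
    rcases hin.lt_or_eq with h | rfl
    · refine ⟨rho n n ^ i * (yy n ^ (n - 1 - i) * rho n 1), ?_⟩
      rw [← mul_assoc, ← yy_pow_eq n i hi hin, ← mul_assoc, ← pow_add,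
        show i + (n - 1 - i) = n - 1 by omega, top]
    · exact ⟨rho i i ^ (i - 1), by rw [← pow_succ', Nat.sub_add_cancel hn]⟩
  · intro w hw
    obtain ⟨b, hb⟩ := hw n hn le_rfl
    rcases hn.lt_or_eq with h | rfl
    · obtain ⟨a, ha⟩ := hw (n - 1) (by omega) (by omega)
      obtain ⟨d, -, hd⟩ := (HL_all n _ (n - 1) n (by omega) (by omega) hn le_rfl a b
        (Nat.lt_succ_self _) (ha.trans hb.symm)).2.1 (by omega)
      refine ⟨d, ?_⟩
      rw [← hb, hd, ← mul_assoc, ← pow_succ', Nat.sub_add_cancel hn]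
    · exact ⟨b, by rw [pow_one, hb]⟩
  · intro i hi hin
    refine ⟨rho n n ^ (i - 1) * yy n ^ (n - i), ?_⟩
    rw [mul_assoc, yy_top n (n - i) i hi (by omega), ← pow_add,
      show i - 1 + (n - i + 1) = n by omega]
  · intro w hw
    obtain ⟨a, ha⟩ := hw 1 le_rfl hn
    rcases hn.lt_or_eq with h | rfl
    · obtain ⟨b, hb⟩ := hw 2 (by omega) (by omega)
      obtain ⟨d, hd, -⟩ := (HR_all n _ 1 2 le_rfl hn (by omega) (by omega) a b
        (Nat.lt_succ_self _) (ha.trans hb.symm)).2.1 (by omega)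
      refine ⟨d, ?_⟩
      rw [← ha, hd, mul_assoc, show n - 2 + 1 = n - 1 by omega, top]
    · exact ⟨a, by rw [pow_one, ha]⟩
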